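/- Let 1 < p ≤ 2 and 2 ≤ r ≤ ∞ satisfy 1/p = 1/r + 1/2, and let (λ_n)_{n∈ℤ} ∈ ℓ_r(ℤ). For f ∈ C[0,1] with Fourier coefficients f̂(n) = ∫₀¹ f(t) e^{2πint} dt, the diagonal operator u_f : ℓ₂(ℤ) → ℓ₂(ℤ) given by u_f(e_n) = λ_n f̂(n) e_n is 2-summing, with π₂(u_f) = (Σ_{n∈ℤ} |λ_n|² |f̂(n)|²)^{1/2} ≤ ‖(λ_n)‖_{ℓ_r} · ‖f‖_{L_p[0,1]}. -/

import Mathlib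

set_option maxHeartbeats 1000000
set_option synthInstance.maxHeartbeats 400000

noncomputable section

open scoped BigOperators NNReal ENNReal
open NormedSpace

/-- The scalar field. -/
notation "𝕂" => ℂ
section Summing

variable {E F : Type} [NormedAddCommGroup E] [NormedSpace 𝕂 E]
  [NormedAddCommGroup F] [NormedSpace 𝕂 F]

/-- The weak ℓ_q norm of a finite family of vectors:
`sup { (Σ_i ‖e*(e_i)‖^q)^(1/q) : e* ∈ E*, ‖e*‖ ≤ 1 }`. -/
def weakNorm (q : ℝ) {n : ℕ} (e : Fin n → E) : ℝ :=
  ⨆ f : {f : StrongDual 𝕂 E // ‖f‖ ≤ 1}, (∑ i, ‖(f : StrongDual 𝕂 E) (e i)‖ ^ q) ^ (1 / q)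

/-- `T` satisfies the (p,q)-summing inequality with constant `C`:
`(Σ_i ‖T e_i‖^p)^(1/p) ≤ C · sup { (Σ_i ‖e*(e_i)‖^q)^(1/q) : ‖e*‖ ≤ 1 }`
for all finite families `e_1, …, e_n`. -/
def SummingWithC (p q C : ℝ) (T : E →L[𝕂] F) : Prop :=
  ∀ (n : ℕ) (e : Fin n → E),
    (∑ i, ‖T (e i)‖ ^ p) ^ (1 / p) ≤ C * weakNorm q e

/-- `T` is (p,q)-summing. -/
def IsPQSumming (p q : ℝ) (T : E →L[𝕂] F) : Prop :=
  ∃ C, 0 ≤ C ∧ SummingWithC p q C T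

/-- `T` is p-summing. -/
def IsPSumming (p : ℝ) (T : E →L[𝕂] F) : Prop := IsPQSumming p p T

/-- The p-summing norm `π_p(T)`: the least admissible constant. -/
def pNorm (p : ℝ) (T : E →L[𝕂] F) : ℝ :=
  sInf {C | 0 ≤ C ∧ SummingWithC p p C T}

end Summing

/-- For `f : C(Ω, 𝕂)` and a vector `y`, the function `f ⊗ y : t ↦ f(t) • y`, under the
identification `C(Ω) ⊗̂_ε H = C(Ω, H)`. -/
def cmSmul {Ω : Type} [TopologicalSpace Ω] {H : Type} [NormedAddCommGroup H]
    [NormedSpace 𝕂 H] (f : C(Ω, 𝕂)) (y : H) : C(Ω, H) :=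
  ⟨fun t => f t • y, (map_continuous f).smul continuous_const⟩

attribute [local instance] MeasureTheory.Measure.Subtype.measureSpace

/-- The n-th Fourier coefficient `φ̂(n) = ∫₀¹ φ(t) e^{2πint} dt` (a Bochner integral) of a
continuous `ℓ₂(ℤ)`-valued function on `[0,1]`. -/
def fourierCoeffCM (φ : C(Set.Icc (0 : ℝ) 1, ↥(lp (fun _ : ℤ => ℂ) 2))) (n : ℤ) :
    ↥(lp (fun _ : ℤ => ℂ) 2) :=
  ∫ t : Set.Icc (0 : ℝ) 1,
    Complex.exp (2 * Real.pi * Complex.I * (n : ℂ) * ((t : ℝ) : ℂ)) • φ t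

/-- The n-th Fourier coefficient `f̂(n) = ∫₀¹ f(t) e^{2πint} dt` of `f ∈ C[0,1]`. -/
def fourierCoeffScalar (f : C(Set.Icc (0 : ℝ) 1, ℂ)) (n : ℤ) : ℂ :=
  ∫ t : Set.Icc (0 : ℝ) 1,
    Complex.exp (2 * Real.pi * Complex.I * (n : ℂ) * ((t : ℝ) : ℂ)) * f t

open MeasureTheory Filter Topology

instance volIccProb : IsProbabilityMeasure (volume : Measure (Set.Icc (0:ℝ) 1)) := by
  constructor
  rw [Measure.Subtype.volume_univ measurableSet_Icc.nullMeasurableSet]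
  simp

lemma cm_integrable {E : Type*} [NormedAddCommGroup E] (h : C(Set.Icc (0:ℝ) 1, E)) :
    Integrable (fun t => h t) (volume : Measure (Set.Icc (0:ℝ) 1)) := by
  exact h.continuous.integrable_of_hasCompactSupport (HasCompactSupport.of_compactSpace _)

/-- exponential -/
def ef (n : ℤ) : C(Set.Icc (0:ℝ) 1, ℂ) :=
  ⟨fun t => Complex.exp (2 * Real.pi * Complex.I * (n : ℂ) * ((t : ℝ) : ℂ)), by fun_prop⟩

lemma ef_norm (n : ℤ) (t) : ‖ef n t‖ = 1 := by
  simp [ef, Complex.norm_exp]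

lemma ef_star (n : ℤ) (t) : star (ef n t) = ef (-n) t := by
  simp [ef, ← Complex.exp_conj, Complex.conj_ofNat]

lemma ef_int (n : ℤ) : ∫ t, ef n t = if n = 0 then 1 else 0 := by
  have h1 : ∫ t, ef n t = ∫ t in (0:ℝ)..1, Complex.exp (2 * Real.pi * Complex.I * (n : ℂ) * (t : ℂ)) := by
    rw [intervalIntegral.integral_of_le zero_le_one, ← integral_Icc_eq_integral_Ioc,
      ← integral_subtype measurableSet_Icc]
    rfl
  rw [h1]
  split_ifs with h
  · subst h; simp
  · have hc : (2 * Real.pi * Complex.I * (n : ℂ)) ≠ 0 := by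
      simp [Complex.I_ne_zero, Real.pi_ne_zero, h]
    rw [integral_exp_mul_complex hc]
    have : Complex.exp (2 * Real.pi * Complex.I * (n : ℂ) * (1:ℝ)) = 1 := by
      rw [Complex.exp_eq_one_iff]; exact ⟨n, by push_cast; ring⟩
    rw [this]; simp

lemma bessel (h : C(Set.Icc (0:ℝ) 1, ℂ)) (S : Finset ℤ) :
    ∑ n ∈ S, ‖fourierCoeffScalar h n‖ ^ 2 ≤ ∫ t, ‖h t‖ ^ 2 := by
  let v : ℤ → Lp ℂ 2 (volume : Measure (Set.Icc (0:ℝ) 1)) :=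
    fun n => ContinuousMap.toLp 2 volume ℂ (ef (-n))
  have hv : Orthonormal ℂ v := by
    rw [orthonormal_iff_ite]
    intro i j
    simp only [v]
    rw [ContinuousMap.inner_toLp]
    have : ∀ t, ef (-j) t * star (ef (-i) t) = ef (i - j) t := by
      intro t
      rw [ef_star]
      simp only [ef, ContinuousMap.coe_mk, ← Complex.exp_add]
      congr 1; push_cast; ring
    have h2 := ef_int (i - j)
    simp only [sub_eq_zero] at h2
    rw [← h2]
    exact integral_congr_ae (Eventually.of_forall this)
  have hb := hv.sum_inner_products_le (s := S) (x := ContinuousMap.toLp 2 volume ℂ h)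
  have e1 : ∀ n, inner ℂ (v n) (ContinuousMap.toLp 2 volume ℂ h) = fourierCoeffScalar h n := by
    intro n
    simp only [v]
    rw [ContinuousMap.inner_toLp]
    refine integral_congr_ae (Eventually.of_forall fun t => ?_)
    have := ef_star (-n) t
    simp only [neg_neg] at this
    change h t * star (ef (-n) t) = _
    rw [this, mul_comm]; rfl
  simp only [e1] at hb
  refine hb.trans (le_of_eq ?_)
  have h3 : ((‖ContinuousMap.toLp 2 volume ℂ h‖ ^ 2 : ℝ) : ℂ) = ((∫ t, ‖h t‖ ^ 2 : ℝ) : ℂ) := by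
    push_cast
    rw [← integral_complex_ofReal]
    have := inner_self_eq_norm_sq_to_K (𝕜 := ℂ) (ContinuousMap.toLp 2 (volume : Measure (Set.Icc (0:ℝ) 1)) ℂ h)
    rw [ContinuousMap.inner_toLp] at this
    erw [← this]
    refine integral_congr_ae (Eventually.of_forall fun t => ?_)
    simp [Complex.mul_conj, Complex.normSq_eq_norm_sq]
  exact_mod_cast h3

lemma diff_int (k L : C(Set.Icc (0:ℝ) 1, ℂ)) :
    Differentiable ℂ (fun z : ℂ => ∫ t, k t * Complex.exp (L t * z)) := by
  intro z₀
  have := hasDerivAt_integral_of_dominated_loc_of_deriv_le (μ := (volume : Measure (Set.Icc (0:ℝ) 1)))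
    (F := fun z t => k t * Complex.exp (L t * z))
    (F' := fun z t => k t * (Complex.exp (L t * z) * L t))
    (bound := fun _ => ‖k‖ * (Real.exp (‖L‖ * (‖z₀‖ + 1)) * ‖L‖)) (x₀ := z₀)
    (Metric.ball_mem_nhds z₀ one_pos)
    (Eventually.of_forall fun z => (Continuous.aestronglyMeasurable (by fun_prop)))
    (cm_integrable ⟨fun t => k t * Complex.exp (L t * z₀), by fun_prop⟩)
    (Continuous.aestronglyMeasurable (by fun_prop))
    (Eventually.of_forall fun t z hz => by
      rw [norm_mul, norm_mul, Complex.norm_exp]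
      have h1 := k.norm_coe_le_norm t
      have h2 := L.norm_coe_le_norm t
      have h3 : ‖z‖ ≤ ‖z₀‖ + 1 := by
        have : ‖z - z₀‖ < 1 := by simpa [dist_eq_norm] using hz
        have := norm_le_norm_add_norm_sub' z z₀
        linarith
      have h4 : (L t * z).re ≤ ‖L‖ * (‖z₀‖ + 1) := by
        refine (Complex.re_le_norm _).trans ?_
        rw [norm_mul]; gcongr
      gcongr)
    (integrable_const _)
    (Eventually.of_forall fun t z _ => by
      have : HasDerivAt (fun z : ℂ => L t * z) (L t) z := by
        simpa using (hasDerivAt_id z).const_mul (L t)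
      exact this.cexp.const_mul _)
  exact this.2.differentiableAt

/-- the analytic family -/
def pw (p w : ℝ) (a z : ℂ) : ℂ :=
  a * Complex.exp ((Real.log w : ℂ) * (p * (1 - z / 2) - 1))

lemma pw_norm_eq (p w : ℝ) (a z : ℂ) :
    ‖pw p w a z‖ = ‖a‖ * Real.exp (Real.log w * (p * (1 - z.re / 2) - 1)) := by
  rw [pw, norm_mul, Complex.norm_exp]
  congr 2
  rw [Complex.re_ofReal_mul]
  congr 1
  simp

lemma pw_le (p w : ℝ) (a z : ℂ) (hw : ‖a‖ ≤ w) :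
    ‖pw p w a z‖ ≤ w ^ (p * (1 - z.re / 2)) := by
  have hw0 : 0 ≤ w := (norm_nonneg a).trans hw
  rw [pw_norm_eq]
  rcases hw0.eq_or_lt with h | h
  · subst h
    have : ‖a‖ = 0 := le_antisymm hw (norm_nonneg _)
    rw [this, zero_mul]; exact Real.rpow_nonneg le_rfl _
  · rw [← Real.rpow_def_of_pos h]
    calc _ ≤ w * w ^ (p * (1 - z.re / 2) - 1) := by gcongr
      _ = w ^ (1 + (p * (1 - z.re / 2) - 1)) := by
        rw [Real.rpow_add h, Real.rpow_one]
      _ = _ := by congr 1; ring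

lemma pw_bdd (p w : ℝ) (hp1 : 1 < p) (hp2 : p ≤ 2) (a z : ℂ) (hz0 : 0 ≤ z.re) (hz1 : z.re ≤ 1) :
    ‖pw p w a z‖ ≤ ‖a‖ * Real.exp |Real.log w| := by
  rw [pw_norm_eq]
  gcongr
  refine (le_abs_self _).trans ?_
  rw [abs_mul]
  refine mul_le_of_le_one_right (abs_nonneg _) ?_
  rw [abs_le]
  constructor <;> nlinarith

lemma pw_diff (p w : ℝ) (a : ℂ) : Differentiable ℂ (pw p w a) := by
  unfold pw; fun_prop

/-- the analytic family of functions -/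
def pwC (p : ℝ) (w : C(Set.Icc (0:ℝ) 1, ℝ)) (hw : ∀ t, 0 < w t)
    (f : C(Set.Icc (0:ℝ) 1, ℂ)) (z : ℂ) : C(Set.Icc (0:ℝ) 1, ℂ) :=
  ⟨fun t => pw p (w t) (f t) z, by
    unfold pw
    have : Continuous (fun t => Real.log (w t)) := w.continuous.log (fun t => (hw t).ne')
    fun_prop⟩

lemma coeff_diff (p : ℝ) (w : C(Set.Icc (0:ℝ) 1, ℝ)) (hw : ∀ t, 0 < w t)
    (f : C(Set.Icc (0:ℝ) 1, ℂ)) (n : ℤ) :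
    Differentiable ℂ (fun z => fourierCoeffScalar (pwC p w hw f z) n) := by
  have hl : Continuous (fun t => Real.log (w t)) := w.continuous.log (fun t => (hw t).ne')
  have := diff_int ⟨fun t => ef n t * f t * Complex.exp ((Real.log (w t) : ℂ) * (p - 1)), by fun_prop⟩
    ⟨fun t => (Real.log (w t) : ℂ) * (- p / 2), by fun_prop⟩
  convert this using 2 with z
  unfold fourierCoeffScalar
  refine integral_congr_ae (Eventually.of_forall fun t => ?_)
  simp only [pwC, pw, ef, ContinuousMap.coe_mk]
  rw [show (Real.log (w t) : ℂ) * (p * (1 - z / 2) - 1) =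
    (Real.log (w t) : ℂ) * (p - 1) + (Real.log (w t) : ℂ) * (- p / 2) * z by ring, Complex.exp_add]
  ring

lemma coeff_le (f : C(Set.Icc (0:ℝ) 1, ℂ)) (n : ℤ) :
    ‖fourierCoeffScalar f n‖ ≤ ∫ t, ‖f t‖ := by
  unfold fourierCoeffScalar
  refine (norm_integral_le_integral_norm _).trans (le_of_eq ?_)
  refine integral_congr_ae (Eventually.of_forall fun t => ?_)
  have := ef_norm n t
  simp only [ef, ContinuousMap.coe_mk] at this
  simp only [norm_mul, this, one_mul]

lemma hy_w (p : ℝ) (hp1 : 1 < p) (hp2 : p ≤ 2) (w : C(Set.Icc (0:ℝ) 1, ℝ)) (hw : ∀ t, 0 < w t)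
    (f : C(Set.Icc (0:ℝ) 1, ℂ)) (hfw : ∀ t, ‖f t‖ ≤ w t) (S : Finset ℤ) (g : ℤ → ℂ) :
    ‖∑ n ∈ S, g n * fourierCoeffScalar f n‖ ≤
      (∑ n ∈ S, ‖g n‖ ^ p) ^ (1 / p) * (∫ t, w t ^ p) ^ (1 / p) := by
  have hp0 : 0 < p := by linarith
  set A := ∑ n ∈ S, ‖g n‖ ^ p with hA
  set B := ∫ t, w t ^ p with hB
  have hA0 : 0 ≤ A := Finset.sum_nonneg fun n _ => by positivity
  have hB0 : 0 ≤ B := integral_nonneg fun t => Real.rpow_nonneg (hw t).le _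
  have hl : Continuous (fun t => Real.log (w t)) := w.continuous.log (fun t => (hw t).ne')
  have hwc : ∀ q : ℝ, Continuous (fun t => w t ^ q) := fun q =>
    w.continuous.rpow_const (fun t => Or.inl (hw t).ne')
  let F : ℂ → ℂ := fun z => ∑ n ∈ S, pw p ‖g n‖ (g n) z * fourierCoeffScalar (pwC p w hw f z) n
  have hFd : Differentiable ℂ F := by
    refine Differentiable.fun_sum fun n _ => ?_
    exact (pw_diff p _ _).mul (coeff_diff p w hw f n)
  have hint : ∀ z, ∫ t, ‖pwC p w hw f z t‖ ≤ ∫ t, w t ^ (p * (1 - z.re / 2)) := by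
    intro z
    refine integral_mono (cm_integrable (pwC p w hw f z)).norm
      (cm_integrable ⟨_, hwc (p * (1 - z.re / 2))⟩) fun t => ?_
    exact pw_le _ _ _ _ (hfw t)
  have hb : BddAbove ((norm ∘ F) '' Complex.HadamardThreeLines.verticalClosedStrip 0 1) := by
    refine ⟨∑ n ∈ S, (‖g n‖ * Real.exp |Real.log ‖g n‖|) *
      ∫ t, (‖f t‖ * Real.exp |Real.log (w t)|), ?_⟩
    rintro _ ⟨z, hz, rfl⟩
    obtain ⟨hz0, hz1⟩ := hz
    refine (norm_sum_le _ _).trans (Finset.sum_le_sum fun n _ => ?_)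
    rw [norm_mul]
    refine mul_le_mul (pw_bdd p _ hp1 hp2 _ _ hz0 hz1) ((coeff_le _ _).trans ?_) (norm_nonneg _)
      (by positivity)
    refine integral_mono (cm_integrable (pwC p w hw f z)).norm
      (cm_integrable ⟨fun t => ‖f t‖ * Real.exp |Real.log (w t)|, by fun_prop⟩) fun t => ?_
    exact pw_bdd p _ hp1 hp2 _ _ hz0 hz1
  have h0 : ∀ z ∈ Complex.re ⁻¹' {0}, ‖F z‖ ≤ A * B := by
    intro z hz
    have hz : z.re = 0 := hz
    rw [hA, Finset.sum_mul]
    refine (norm_sum_le _ _).trans (Finset.sum_le_sum fun n _ => ?_)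
    rw [norm_mul]
    have h1 := pw_le p ‖g n‖ (g n) z le_rfl
    have h2 := (coeff_le (pwC p w hw f z) n).trans (hint z)
    simp only [hz, zero_div, sub_zero, mul_one] at h1 h2
    exact mul_le_mul h1 h2 (norm_nonneg _) (by positivity)
  have h1 : ∀ z ∈ Complex.re ⁻¹' {1}, ‖F z‖ ≤ (A * B) ^ (1 / 2 : ℝ) := by
    intro z hz
    have hz : z.re = 1 := hz
    have e : ∀ x : ℝ, 0 ≤ x → (x ^ (p * (1 - z.re / 2))) ^ 2 = x ^ p := by
      intro x hx
      rw [← Real.rpow_natCast, ← Real.rpow_mul hx, hz]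
      congr 1; push_cast; ring
    have hs1 : ∑ n ∈ S, ‖pw p ‖g n‖ (g n) z‖ ^ 2 ≤ A := by
      refine Finset.sum_le_sum fun n _ => ?_
      rw [← e _ (norm_nonneg _)]
      gcongr
      exact pw_le p ‖g n‖ (g n) z le_rfl
    have hs2 : ∑ n ∈ S, ‖fourierCoeffScalar (pwC p w hw f z) n‖ ^ 2 ≤ B := by
      refine (bessel _ S).trans ?_
      refine integral_mono (cm_integrable ⟨fun t => ‖pwC p w hw f z t‖ ^ 2, by fun_prop⟩)
        (cm_integrable ⟨_, hwc p⟩) fun t => ?_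
      simp only
      rw [← e _ (hw t).le]
      gcongr
      exact pw_le _ _ _ _ (hfw t)
    rw [← Real.sqrt_eq_rpow]
    apply Real.le_sqrt_of_sq_le
    calc ‖F z‖ ^ 2 ≤ (∑ n ∈ S, ‖pw p ‖g n‖ (g n) z‖ * ‖fourierCoeffScalar (pwC p w hw f z) n‖) ^ 2 := by
          gcongr
          refine (norm_sum_le _ _).trans (le_of_eq ?_)
          simp only [norm_mul]
      _ ≤ _ := Finset.sum_mul_sq_le_sq_mul_sq _ _ _
      _ ≤ A * B := by gcongr
  set θ : ℝ := 2 - 2 / p with hθ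
  have hθ0 : 0 ≤ θ := by
    have : 2 / p ≤ 2 := by rw [div_le_iff₀ hp0]; linarith
    linarith
  have hθ1 : θ ≤ 1 := by
    have : 1 ≤ 2 / p := by rw [le_div_iff₀ hp0]; linarith
    linarith
  have key := Complex.HadamardThreeLines.norm_le_interp_of_mem_verticalClosedStrip₀₁' F (z := (θ : ℂ))
    (by exact ⟨by simpa using hθ0, by simpa using hθ1⟩) hFd.diffContOnCl hb h0 h1
  have hFθ : F θ = ∑ n ∈ S, g n * fourierCoeffScalar f n := by
    have hex : (p : ℂ) * (1 - (θ : ℂ) / 2) - 1 = 0 := by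
      have : p * (1 - θ / 2) - 1 = 0 := by rw [hθ]; field_simp; ring
      exact_mod_cast this
    have h3 : ∀ w a, pw p w a θ = a := by
      intro w a; simp [pw, hex]
    have h4 : pwC p w hw f θ = f := by ext t; exact h3 _ _
    simp only [F, h3, h4]
  rw [hFθ] at key
  refine key.trans (le_of_eq ?_)
  rw [Complex.ofReal_re, ← Real.rpow_mul (mul_nonneg hA0 hB0), ← Real.mul_rpow hA0 hB0]
  have hp' : 0 < 1 / p := by positivity
  rcases (mul_nonneg hA0 hB0).eq_or_lt with h | h
  · rw [← h]
    rw [Real.zero_rpow hp'.ne']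
    by_cases h5 : θ = 0
    · exfalso
      have : 2 / p = 2 := by linarith
      rw [div_eq_iff hp0.ne'] at this; linarith
    · rw [Real.zero_rpow (x := 1 / 2 * θ) (by simpa using h5), mul_zero]
  · rw [← Real.rpow_add h]
    congr 1
    rw [hθ]; field_simp; ring

lemma hy (p : ℝ) (hp1 : 1 < p) (hp2 : p ≤ 2)
    (f : C(Set.Icc (0:ℝ) 1, ℂ)) (S : Finset ℤ) (g : ℤ → ℂ) :
    ‖∑ n ∈ S, g n * fourierCoeffScalar f n‖ ≤
      (∑ n ∈ S, ‖g n‖ ^ p) ^ (1 / p) * (∫ t, ‖f t‖ ^ p) ^ (1 / p) := by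
  have hp0 : 0 < p := by linarith
  have hc : Continuous (fun ε : ℝ => ∫ t : Set.Icc (0:ℝ) 1, (‖f t‖ + |ε|) ^ p) := by
    have := continuous_parametric_integral_of_continuous
      (μ := (volume : Measure (Set.Icc (0:ℝ) 1)))
      (f := fun (ε : ℝ) (t : Set.Icc (0:ℝ) 1) => (‖f t‖ + |ε|) ^ p)
      (by
        refine Continuous.rpow_const ?_ (fun _ => Or.inr hp0.le)
        fun_prop) isCompact_univ
    simpa using this
  have ht : Tendsto (fun ε : ℝ => (∑ n ∈ S, ‖g n‖ ^ p) ^ (1 / p) *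
      (∫ t : Set.Icc (0:ℝ) 1, (‖f t‖ + |ε|) ^ p) ^ (1 / p)) (𝓝[>] 0)
      (𝓝 ((∑ n ∈ S, ‖g n‖ ^ p) ^ (1 / p) * (∫ t, ‖f t‖ ^ p) ^ (1 / p))) := by
    have h2 : Continuous (fun ε : ℝ => (∑ n ∈ S, ‖g n‖ ^ p) ^ (1 / p) *
      (∫ t : Set.Icc (0:ℝ) 1, (‖f t‖ + |ε|) ^ p) ^ (1 / p)) :=
      continuous_const.mul (hc.rpow_const fun _ => Or.inr (by positivity))
    have h3 := h2.tendsto 0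
    simp only [abs_zero, add_zero] at h3
    exact h3.mono_left nhdsWithin_le_nhds
  refine ge_of_tendsto ht ?_
  filter_upwards [self_mem_nhdsWithin] with ε (hε : 0 < ε)
  have hε' : 0 < |ε| := abs_pos.mpr hε.ne'
  exact hy_w p hp1 hp2 ⟨fun t => ‖f t‖ + |ε|, by fun_prop⟩ (fun t => by
    simp only [ContinuousMap.coe_mk]; positivity) f (fun t => by simp) S g

lemma holder_part (p : ℝ) (r : ℝ≥0∞) [Fact (1 ≤ r)] (hp1 : 1 < p) (hp2 : p ≤ 2)
    (hr : 2 ≤ r) (hpr : 1 / ENNReal.ofReal p = 1 / r + 1 / 2)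
    (lam : ↥(lp (fun _ : ℤ => ℂ) r)) (S : Finset ℤ) (c : ℤ → ℂ) :
    (∑ n ∈ S, ‖lam n * c n‖ ^ p) ^ (1 / p) ≤ ‖lam‖ * (∑ n ∈ S, ‖c n‖ ^ (2:ℝ)) ^ (1 / 2 : ℝ) := by
  have hp0 : 0 < p := by linarith
  have hr0 : r ≠ 0 := by intro h; simp [h] at hr
  have hpr' : 1 / p = (1 / r).toReal + 1 / 2 := by
    have := congrArg ENNReal.toReal hpr
    rw [ENNReal.toReal_add (by simp [hr0]) (by simp)] at this
    simpa [ENNReal.toReal_ofReal hp0.le] using this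
  by_cases hrt : r = ∞
  · subst hrt
    have : p = 2 := by
      simp at hpr'; linarith
    subst this
    have h1 : ∑ n ∈ S, ‖lam n * c n‖ ^ (2:ℝ) ≤ ‖lam‖ ^ (2:ℝ) * ∑ n ∈ S, ‖c n‖ ^ (2:ℝ) := by
      rw [Finset.mul_sum]
      refine Finset.sum_le_sum fun n _ => ?_
      rw [norm_mul, Real.mul_rpow (norm_nonneg _) (norm_nonneg _)]
      gcongr
      exact lp.norm_apply_le_norm hr0 lam n
    calc _ ≤ (‖lam‖ ^ (2:ℝ) * ∑ n ∈ S, ‖c n‖ ^ (2:ℝ)) ^ (1 / 2 : ℝ) := by gcongr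
      _ = _ := by
        rw [Real.mul_rpow (by positivity) (by positivity), ← Real.rpow_mul (norm_nonneg _)]
        norm_num
  · set q := r.toReal with hq
    have hq0 : 0 < q := ENNReal.toReal_pos hr0 hrt
    have htri : q.HolderTriple 2 p := by
      refine ⟨?_, hq0, by norm_num⟩
      simp at hpr'
      rw [hpr']
    have h1 := Real.Lr_rpow_le_Lp_mul_Lq_of_nonneg S (f := fun n => ‖lam n‖) (g := fun n => ‖c n‖)
      htri (fun _ _ => norm_nonneg _) (fun _ _ => norm_nonneg _)
    have h2 := lp.sum_rpow_le_norm_rpow hq0 lam S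
    simp only [norm_mul]
    have hX : 0 ≤ ∑ n ∈ S, ‖c n‖ ^ (2:ℝ) := by positivity
    calc _ ≤ ((‖lam‖ ^ q) ^ (p / q) * (∑ n ∈ S, ‖c n‖ ^ (2:ℝ)) ^ (p / 2)) ^ (1 / p) := by
          gcongr
          refine h1.trans ?_
          gcongr
      _ = _ := by
        rw [Real.mul_rpow (by positivity) (by positivity), ← Real.rpow_mul (by positivity),
          ← Real.rpow_mul (by positivity), ← Real.rpow_mul (by positivity)]
        congr 1
        · rw [show q * (p / q * (1 / p)) = 1 by field_simp, Real.rpow_one]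
        · congr 1; field_simp

lemma main_bound (p : ℝ) (r : ℝ≥0∞) [Fact (1 ≤ r)] (hp1 : 1 < p) (hp2 : p ≤ 2)
    (hr : 2 ≤ r) (hpr : 1 / ENNReal.ofReal p = 1 / r + 1 / 2)
    (lam : ↥(lp (fun _ : ℤ => ℂ) r)) (f : C(Set.Icc (0 : ℝ) 1, ℂ)) (S : Finset ℤ) :
    (∑ n ∈ S, ‖lam n * fourierCoeffScalar f n‖ ^ 2) ≤
      (‖lam‖ * (∫ t : Set.Icc (0 : ℝ) 1, ‖f t‖ ^ p) ^ (1 / p)) ^ 2 := by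
  set d : ℤ → ℂ := fun n => lam n * fourierCoeffScalar f n with hd
  set X := ∑ n ∈ S, ‖d n‖ ^ 2 with hX
  have hX0 : 0 ≤ X := by positivity
  have hN : 0 ≤ (∫ t : Set.Icc (0 : ℝ) 1, ‖f t‖ ^ p) ^ (1 / p) :=
    Real.rpow_nonneg (integral_nonneg fun t => by positivity) _
  have h1 := hy p hp1 hp2 f S (fun n => lam n * star (d n))
  have h2 := holder_part p r hp1 hp2 hr hpr lam S (fun n => star (d n))
  have e1 : ∑ n ∈ S, lam n * star (d n) * fourierCoeffScalar f n = (X : ℂ) := by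
    rw [hX]; push_cast
    refine Finset.sum_congr rfl fun n _ => ?_
    rw [← Complex.ofReal_pow, ← Complex.normSq_eq_norm_sq, ← Complex.mul_conj]
    simp only [hd, RCLike.star_def]; ring
  rw [e1, Complex.norm_real, Real.norm_of_nonneg hX0] at h1
  have e2 : (∑ n ∈ S, ‖star (d n)‖ ^ (2:ℝ)) ^ (1 / 2 : ℝ) = √X := by
    rw [Real.sqrt_eq_rpow]; simp [hX]
  rw [e2] at h2
  have h3 : X ≤ ‖lam‖ * √X * (∫ t : Set.Icc (0 : ℝ) 1, ‖f t‖ ^ p) ^ (1 / p) :=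
    h1.trans (by gcongr)
  have h4 : √X ≤ ‖lam‖ * (∫ t : Set.Icc (0 : ℝ) 1, ‖f t‖ ^ p) ^ (1 / p) := by
    rcases (Real.sqrt_nonneg X).eq_or_lt with h | h
    · rw [← h]; positivity
    · have := Real.mul_self_sqrt hX0
      nlinarith
  rw [← Real.sq_sqrt hX0]
  gcongr

section diag

lemma weak_bdd {n : ℕ} {E : Type} [NormedAddCommGroup E] [NormedSpace ℂ E] (e : Fin n → E) :
    BddAbove (Set.range fun f : {f : StrongDual ℂ E // ‖f‖ ≤ 1} =>
      (∑ i, ‖(f : StrongDual ℂ E) (e i)‖ ^ (2:ℝ)) ^ (1 / (2:ℝ))) := by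
  refine ⟨(∑ i, ‖e i‖ ^ (2:ℝ)) ^ (1 / (2:ℝ)), ?_⟩
  rintro _ ⟨f, rfl⟩
  simp only
  gcongr with i
  exact ((f : StrongDual ℂ E).le_of_opNorm_le f.2 _).trans (by simp)

lemma weak_nonneg {n : ℕ} {E : Type} [NormedAddCommGroup E] [NormedSpace ℂ E] (e : Fin n → E) :
    0 ≤ weakNorm 2 e :=
  Real.iSup_nonneg fun f => by positivity

lemma l2_sq (x : ↥(lp (fun _ : ℤ => ℂ) 2)) : HasSum (fun n => ‖x n‖ ^ 2) (‖x‖ ^ 2) := by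
  simpa using lp.hasSum_norm (p := 2) (by norm_num) x

lemma coord_le {k : ℕ} (e : Fin k → ↥(lp (fun _ : ℤ => ℂ) 2)) (n : ℤ) :
    ∑ i, ‖e i n‖ ^ 2 ≤ weakNorm 2 e ^ 2 := by
  have h : ‖lp.evalCLM ℂ (fun _ : ℤ => ℂ) 2 n‖ ≤ 1 :=
    LinearMap.mkContinuous_norm_le _ zero_le_one _
  have := le_ciSup (weak_bdd e) ⟨lp.evalCLM ℂ (fun _ : ℤ => ℂ) 2 n, h⟩
  change (∑ i, ‖e i n‖ ^ (2:ℝ)) ^ (1 / (2:ℝ)) ≤ weakNorm 2 e at this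
  rw [← Real.sqrt_eq_rpow] at this
  rw [Real.sqrt_le_left (weak_nonneg e)] at this
  simpa using this

lemma weak_basis (k : ℕ) (m : Fin k → ℤ) (hm : Function.Injective m) :
    weakNorm 2 (fun i => lp.single (E := fun _ : ℤ => ℂ) 2 (m i) (1:ℂ)) ≤ 1 := by
  have : Nonempty {f : StrongDual ℂ ↥(lp (fun _ : ℤ => ℂ) 2) // ‖f‖ ≤ 1} := ⟨⟨0, by simp⟩⟩
  refine ciSup_le fun f => ?_
  obtain ⟨f, hf⟩ := f
  simp only
  set a : Fin k → ℂ := fun i => f (lp.single (E := fun _ : ℤ => ℂ) 2 (m i) (1:ℂ)) with ha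
  have e0 : ∑ i, ‖a i‖ ^ (2:ℝ) = ∑ i, ‖a i‖ ^ 2 := by simp
  change (∑ i, ‖a i‖ ^ (2:ℝ)) ^ (1 / (2:ℝ)) ≤ 1
  rw [e0, ← Real.sqrt_eq_rpow]
  set B := ∑ i, ‖a i‖ ^ 2 with hB
  have hB0 : 0 ≤ B := by positivity
  set x : ↥(lp (fun _ : ℤ => ℂ) 2) :=
    ∑ i, star (a i) • lp.single (E := fun _ : ℤ => ℂ) 2 (m i) (1:ℂ) with hx
  have h1 : f x = (B : ℂ) := by
    rw [hx, map_sum, hB]; push_cast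
    refine Finset.sum_congr rfl fun i _ => ?_
    rw [map_smul, ← Complex.ofReal_pow, ← Complex.normSq_eq_norm_sq, ← Complex.mul_conj,
      smul_eq_mul, mul_comm]; rfl
  have h2 : ‖x‖ ^ 2 = B := by
    have hon : Orthonormal ℂ (fun i => lp.single (E := fun _ : ℤ => ℂ) 2 (m i) (1:ℂ)) := by
      rw [orthonormal_iff_ite]
      intro i j
      rw [lp.inner_single_left]
      by_cases h : i = j
      · subst h; simp
      · have : m i ≠ m j := fun h' => h (hm h')
        simp [h, lp.single_apply, this]
    have := hon.inner_sum (fun i => star (a i)) (fun i => star (a i)) Finset.univ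
    rw [← hx, inner_self_eq_norm_sq_to_K] at this
    have h3 : ((‖x‖ ^ 2 : ℝ) : ℂ) = (B : ℂ) := by
      push_cast
      erw [this]
      rw [hB]; push_cast
      refine Finset.sum_congr rfl fun i _ => ?_
      rw [← Complex.ofReal_pow, ← Complex.normSq_eq_norm_sq, ← Complex.mul_conj]
      simp
    exact_mod_cast h3
  have h3 : ‖f x‖ ≤ ‖x‖ := (f.le_of_opNorm_le hf _).trans (by simp)
  rw [h1, Complex.norm_real, Real.norm_of_nonneg hB0] at h3
  rw [Real.sqrt_le_one]
  by_contra hlt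
  push Not at hlt
  nlinarith [norm_nonneg x]

lemma diag_main (d : ℤ → ℂ) (M : ℝ) (hM : 0 ≤ M) (hd : ∀ S : Finset ℤ, ∑ n ∈ S, ‖d n‖ ^ 2 ≤ M ^ 2) :
    ∃ u : ↥(lp (fun _ : ℤ => ℂ) 2) →L[ℂ] ↥(lp (fun _ : ℤ => ℂ) 2),
      (∀ (x : ↥(lp (fun _ : ℤ => ℂ) 2)) (n : ℤ), (u x : ∀ _ : ℤ, ℂ) n = d n * x n) ∧
      IsPSumming 2 u ∧ pNorm 2 u = √(∑' n : ℤ, ‖d n‖ ^ 2) ∧ pNorm 2 u ≤ M := by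
  have hsum : Summable (fun n => ‖d n‖ ^ 2) :=
    summable_of_sum_le (fun n => by positivity) hd
  have hdn : ∀ n, ‖d n‖ ≤ M := fun n => by
    have := hd {n}
    rw [Finset.sum_singleton] at this
    exact (pow_le_pow_iff_left₀ (norm_nonneg _) hM two_ne_zero).1 this
  have hbd : ∀ x : ↥(lp (fun _ : ℤ => ℂ) 2), ∀ n, ‖d n * x n‖ ^ 2 ≤ M ^ 2 * ‖x n‖ ^ 2 := by
    intro x n
    rw [norm_mul, mul_pow]
    gcongr
    exact hdn n
  have hmem : ∀ x : ↥(lp (fun _ : ℤ => ℂ) 2), Memℓp (fun n => d n * x n) 2 := by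
    intro x
    refine memℓp_gen ?_
    have : Summable (fun n => ‖d n * x n‖ ^ 2) :=
      Summable.of_nonneg_of_le (fun n => by positivity) (hbd x) ((l2_sq x).summable.mul_left _)
    simpa using this
  let uL : ↥(lp (fun _ : ℤ => ℂ) 2) →ₗ[ℂ] ↥(lp (fun _ : ℤ => ℂ) 2) :=
    { toFun := fun x => ⟨fun n => d n * x n, hmem x⟩
      map_add' := fun x y => by
        ext n; exact mul_add _ _ _
      map_smul' := fun c x => by
        ext n; simp; ring }
  have huL : ∀ x n, uL x n = d n * x n := fun x n => rfl
  let u := uL.mkContinuous M (fun x => by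
    have h1 := l2_sq (uL x)
    have h2 := (l2_sq x).mul_left (M ^ 2)
    have h3 := hasSum_le (hbd x) h1 h2
    rw [← mul_pow] at h3
    exact (pow_le_pow_iff_left₀ (norm_nonneg _) (by positivity) two_ne_zero).1 h3)
  have hu : ∀ x n, u x n = d n * x n := huL
  set D := ∑' n : ℤ, ‖d n‖ ^ 2 with hD
  have hD0 : 0 ≤ D := tsum_nonneg fun n => by positivity
  have hS : SummingWithC 2 2 (√D) u := by
    intro k e
    rw [← Real.sqrt_eq_rpow]
    have h0 := weak_nonneg e
    rw [Real.sqrt_le_left (by positivity), mul_pow, Real.sq_sqrt hD0]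
    have h1 : HasSum (fun n => ∑ i, ‖u (e i) n‖ ^ 2) (∑ i, ‖u (e i)‖ ^ 2) :=
      hasSum_sum fun i _ => l2_sq (u (e i))
    have h2 : HasSum (fun n => ‖d n‖ ^ 2 * weakNorm 2 e ^ 2) (D * weakNorm 2 e ^ 2) :=
      hsum.hasSum.mul_right _
    have h3 := hasSum_le (fun n => ?_) h1 h2
    · simpa using h3
    · simp only [hu, norm_mul, mul_pow, ← Finset.mul_sum]
      gcongr
      exact coord_le e n
  have hlow : ∀ C, 0 ≤ C → SummingWithC 2 2 C u → √D ≤ C := by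
    intro C hC h
    rw [Real.sqrt_le_left hC]
    refine hsum.tsum_le_of_sum_le fun S => ?_
    let m : Fin S.card → ℤ := fun i => (S.equivFin.symm i : ℤ)
    have hm : Function.Injective m := Subtype.val_injective.comp S.equivFin.symm.injective
    have h1 := h S.card (fun i => lp.single (E := fun _ : ℤ => ℂ) 2 (m i) (1:ℂ))
    have h2 := weak_basis _ m hm
    have h3 := h1.trans (mul_le_of_le_one_right hC h2)
    rw [← Real.sqrt_eq_rpow, Real.sqrt_le_left hC] at h3
    have h4 : ∀ i, ‖u (lp.single (E := fun _ : ℤ => ℂ) 2 (m i) (1:ℂ))‖ = ‖d (m i)‖ := by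
      intro i
      have : u (lp.single (E := fun _ : ℤ => ℂ) 2 (m i) (1:ℂ)) =
          lp.single (E := fun _ : ℤ => ℂ) 2 (m i) (d (m i)) := by
        ext n
        rw [hu]
        by_cases hn : n = m i
        · subst hn; simp
        · simp [lp.single_apply, hn]
      rw [this, lp.norm_single (by norm_num)]
    simp only [h4, Real.rpow_two] at h3
    refine le_trans (le_of_eq ?_) h3
    rw [← Finset.sum_coe_sort S, ← S.equivFin.symm.sum_comp]
  have hp : pNorm 2 u = √D := by
    refine IsLeast.csInf_eq ⟨⟨Real.sqrt_nonneg _, hS⟩, fun C hC => hlow C hC.1 hC.2⟩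
  refine ⟨u, hu, ⟨√D, Real.sqrt_nonneg _, hS⟩, hp, ?_⟩
  rw [hp, Real.sqrt_le_left hM]
  exact hsum.tsum_le_of_sum_le hd

end diag

/-- let `1 < p ≤ 2` and `2 ≤ r ≤ ∞` with `1/p = 1/r + 1/2`, and let
`(λ_n)_{n ∈ ℤ} ∈ ℓ_r(ℤ)`.  For `f ∈ C[0,1]`, the diagonal operator
`u_f : ℓ₂(ℤ) → ℓ₂(ℤ)`, `u_f e_n = λ_n f̂(n) e_n`, is 2-summing, with
`π₂(u_f) = (Σ_n |λ_n|² |f̂(n)|²)^(1/2) ≤ ‖(λ_n)‖_{ℓ_r} · ‖f‖_{L_p[0,1]}`. -/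
theorem statement13 (p : ℝ) (r : ℝ≥0∞) [Fact (1 ≤ r)] (hp1 : 1 < p) (hp2 : p ≤ 2)
    (hr : 2 ≤ r) (hpr : 1 / ENNReal.ofReal p = 1 / r + 1 / 2)
    (lam : ↥(lp (fun _ : ℤ => ℂ) r)) (f : C(Set.Icc (0 : ℝ) 1, ℂ)) :
    ∃ u : ↥(lp (fun _ : ℤ => ℂ) 2) →L[ℂ] ↥(lp (fun _ : ℤ => ℂ) 2),
      (∀ (x : ↥(lp (fun _ : ℤ => ℂ) 2)) (n : ℤ),
          (u x : ∀ _ : ℤ, ℂ) n = lam n * fourierCoeffScalar f n * x n) ∧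
      IsPSumming 2 u ∧
      pNorm 2 u =
        (∑' n : ℤ, ‖lam n‖ ^ (2 : ℝ) * ‖fourierCoeffScalar f n‖ ^ (2 : ℝ)) ^ ((1 : ℝ) / 2) ∧
      pNorm 2 u ≤
        ‖lam‖ * (∫ t : Set.Icc (0 : ℝ) 1, ‖f t‖ ^ p) ^ (1 / p) := by
  have hN : 0 ≤ ‖lam‖ * (∫ t : Set.Icc (0 : ℝ) 1, ‖f t‖ ^ p) ^ (1 / p) :=
    mul_nonneg (norm_nonneg _)
      (Real.rpow_nonneg (MeasureTheory.integral_nonneg fun t => by positivity) _)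
  obtain ⟨u, h1, h2, h3, h4⟩ := diag_main (fun n => lam n * fourierCoeffScalar f n) _ hN
    (main_bound p r hp1 hp2 hr hpr lam f)
  refine ⟨u, h1, h2, ?_, h4⟩
  rw [h3, Real.sqrt_eq_rpow]
  simp [mul_pow]
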